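/- There exist ε ∈ (0,π) and a sequence (v_n)_{n≥0} in ℂ² with v₀ = (0, 1), v₁ = (iμ/((2k+1)√(1+ζ)), 0), and v₂ = (0, k/12 + ζ/(4(1+ζ)) + (ζk − ξ)/(2(1+ζ)) − μ²/(2(2k+1)(1+ζ))), such that the series v(θ) = Σ_{n≥0} v_n θ^{k+n} converges for all θ ∈ (0,ε) and the function v : (0,ε) → ℂ² so defined is differentiable and satisfies v'(θ) = A(θ) v(θ) for all θ ∈ (0,ε). -/

import Mathlib

open Set Matrix

noncomputable def Amat (k ζ ξ μ : ℝ) (θ : ℝ) : Matrix (Fin 2) (Fin 2) ℂ :=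
  (Complex.I * (μ : ℂ) / ((Real.sqrt (1 + ζ * Real.cos θ ^ 2) : ℝ) : ℂ)) •
      (!![0, 1; 1, 0] : Matrix (Fin 2) (Fin 2) ℂ) -
    ((k / Real.sin θ : ℝ) : ℂ) • (!![1, 0; 0, -1] : Matrix (Fin 2) (Fin 2) ℂ) +
    ((ζ * Real.sin (2 * θ) / (4 * (1 + ζ * Real.cos θ ^ 2)) : ℝ) : ℂ) •
      (1 : Matrix (Fin 2) (Fin 2) ℂ) -
    (((ζ * k - ξ) * Real.sin θ / (1 + ζ * Real.cos θ ^ 2) : ℝ) : ℂ) •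
      (!![1, 0; 0, -1] : Matrix (Fin 2) (Fin 2) ℂ)


open Filter Topology

lemma aux_ser {f : ℝ → ℝ} (hf : AnalyticAt ℝ f 0) : ∃ c : ℕ → ℝ, c 0 = f 0 ∧ c 1 = deriv f 0 ∧
    ∀ᶠ t in 𝓝 (0:ℝ), HasSum (fun n => c n * t ^ n) (f t) := by
  obtain ⟨p, hp⟩ := hf
  refine ⟨p.coeff, ?_, ?_, ?_⟩
  · exact hp.coeff_zero 1
  · rw [hp.deriv]; rfl
  · have := hasFPowerSeriesAt_iff.1 hp
    filter_upwards [this] with t ht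
    simpa [mul_comm] using ht

lemma aux_dslope {f : ℝ → ℝ} (hf : AnalyticAt ℝ f 0) : AnalyticAt ℝ (dslope f 0) 0 := by
  obtain ⟨p, hp⟩ := hf
  exact ⟨_, hp.has_fpower_series_dslope_fslope⟩

lemma aux_even {f : ℝ → ℝ} (hf : ∀ x, f (-x) = f x) : deriv f 0 = 0 := by
  have h := deriv_comp_neg f 0
  have h2 : (fun x => f (-x)) = f := funext hf
  rw [h2] at h
  simp at h
  linarith

lemma aux_sinc : ∃ D : ℝ → ℝ, AnalyticAt ℝ D 0 ∧ D 0 = -1/6 ∧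
    ∀ t, Real.sinc t = 1 + t * (t * D t) := by
  have h1 : AnalyticAt ℝ Real.sinc 0 := by
    rw [Real.sinc_eq_dslope]; exact aux_dslope Real.analyticAt_sin
  have h2 := aux_dslope h1
  have h3 := aux_dslope h2
  have e1 : dslope Real.sinc 0 0 = 0 := by
    rw [dslope_same]; exact aux_even Real.sinc_neg
  have key : ∀ t, Real.sinc t = 1 + t * (t * dslope (dslope Real.sinc 0) 0 t) := by
    intro t
    have a := sub_smul_dslope (dslope Real.sinc 0) 0 t
    have b := sub_smul_dslope Real.sinc 0 t
    rw [e1] at a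
    simp only [sub_zero, smul_eq_mul, Real.sinc_zero] at a b
    rw [a, b]; ring
  refine ⟨_, h3, ?_, key⟩
  have hc := h3.continuousAt.tendsto
  have l1 : Tendsto (dslope (dslope Real.sinc 0) 0) (𝓝[≠] 0) (𝓝 (dslope (dslope Real.sinc 0) 0 0)) :=
    hc.mono_left nhdsWithin_le_nhds
  refine tendsto_nhds_unique l1 ?_
  rw [tendsto_iff_norm_sub_tendsto_zero]
  have l2 : Tendsto (fun t : ℝ => t ^ 2 / 100) (𝓝[≠] 0) (𝓝 0) := by
    have : Continuous (fun t : ℝ => t ^ 2 / 100) := by fun_prop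
    have := this.tendsto 0
    simp at this
    exact this.mono_left nhdsWithin_le_nhds
  refine squeeze_zero' (Eventually.of_forall fun _ => norm_nonneg _) ?_ l2
  have ev : ∀ᶠ t : ℝ in 𝓝[≠] 0, |t| ≤ 1 := by
    apply mem_nhdsWithin_of_mem_nhds
    filter_upwards [Metric.ball_mem_nhds (0:ℝ) one_pos] with t ht
    simp at ht; exact ht.le
  filter_upwards [ev, self_mem_nhdsWithin] with t ht h0
  have h0 : t ≠ 0 := h0
  have hb := Real.sin_bound ht
  have hk := key t
  rw [Real.sinc_of_ne_zero h0, div_eq_iff h0] at hk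
  rw [hk] at hb
  have hp : 0 < |t| ^ 3 := by positivity
  have : (1 + t * (t * dslope (dslope Real.sinc 0) 0 t)) * t - (t - t ^ 3 / 6)
    = t ^ 3 * (dslope (dslope Real.sinc 0) 0 t - -1 / 6) := by ring
  rw [this, abs_mul, abs_pow] at hb
  rw [Real.norm_eq_abs, ← sq_abs t]
  have : |t| ^ 3 * |dslope (dslope Real.sinc 0) 0 t - -1 / 6| ≤ |t| ^ 3 * (|t| ^ 2 / 100) := by
    refine hb.trans (le_of_eq (by ring))
  exact le_of_mul_le_mul_left this hp

lemma aux_bound {f : ℝ → ℝ} {c : ℕ → ℝ}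
    (h : ∀ᶠ t in 𝓝 (0:ℝ), HasSum (fun n => c n * t ^ n) (f t)) :
    ∃ C, 0 ≤ C ∧ ∃ ρ₀ : ℝ, 0 < ρ₀ ∧ ∀ ρ, ρ₀ ≤ ρ → ∀ n, |c n| ≤ C * ρ ^ n := by
  obtain ⟨δ, hδ, h⟩ := Metric.eventually_nhds_iff.1 h
  have hs := (h (y := δ/2) (by simp [abs_of_pos hδ]; linarith)).summable
  obtain ⟨C, hC⟩ := hs.tendsto_atTop_zero.norm.bddAbove_range
  have hC' : ∀ n, |c n| * (δ/2) ^ n ≤ C := by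
    intro n
    have := hC (mem_range_self n)
    simp only [Real.norm_eq_abs, abs_mul, abs_pow] at this
    rwa [abs_of_pos (by positivity : 0 < δ/2)] at this
  have hC0 : 0 ≤ C := le_trans (by positivity) (hC' 0)
  refine ⟨C, hC0, (δ/2)⁻¹, by positivity, fun ρ hρ n => ?_⟩
  calc |c n| = |c n| * (δ/2) ^ n * ((δ/2)⁻¹) ^ n := by
        rw [mul_assoc, ← mul_pow, mul_inv_cancel₀ (by positivity)]; simp
    _ ≤ C * ρ ^ n := by
        gcongr
        exact hC' n

lemma aux_cons {c : ℕ → ℝ} {a t s : ℝ} (h : HasSum (fun n => c n * t ^ n) s) :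
    HasSum (fun n => (Nat.casesOn n a c : ℝ) * t ^ n) (a + t * s) := by
  rw [← hasSum_nat_add_iff' 1]
  simp
  convert! h.mul_left t using 2
  ring

lemma aux_growth {u : ℕ → ℝ} {C ρ : ℝ} (hC : 0 ≤ C) (hρ : 0 < ρ)
    (h : ∀ n, 1 ≤ n → u n ≤ C * ∑ j ∈ Finset.range n, ρ ^ (n - j) * u j) (hu : ∀ n, 0 ≤ u n):
    ∀ n, u n ≤ u 0 * (1 + C) * (ρ * (1 + C)) ^ n := by
  have hS : ∀ n, ∑ j ∈ Finset.range (n+1), (ρ⁻¹) ^ j * u j ≤ u 0 * (1 + C) ^ n := by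
    intro n
    induction n with
    | zero => simp
    | succ n ih =>
      rw [Finset.sum_range_succ]
      have h1 := h (n+1) (by omega)
      have h2 : (ρ⁻¹) ^ (n+1) * u (n+1) ≤ C * ∑ j ∈ Finset.range (n+1), (ρ⁻¹) ^ j * u j := by
        calc _ ≤ (ρ⁻¹) ^ (n+1) * (C * ∑ j ∈ Finset.range (n+1), ρ ^ (n + 1 - j) * u j) := by gcongr
          _ = _ := by
            rw [mul_left_comm, Finset.mul_sum]
            congr 1
            refine Finset.sum_congr rfl fun j hj => ?_
            have hj : j ≤ n + 1 := by simp at hj; omega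
            obtain ⟨m, hm⟩ := Nat.exists_eq_add_of_le hj
            rw [hm, Nat.add_sub_cancel_left, pow_add, ← mul_assoc, mul_assoc ((ρ⁻¹)^j), ← mul_pow,
              inv_mul_cancel₀ hρ.ne']
            simp
      calc _ ≤ (1 + C) * ∑ j ∈ Finset.range (n+1), (ρ⁻¹) ^ j * u j := by linarith
        _ ≤ (1 + C) * (u 0 * (1 + C) ^ n) := by gcongr
        _ = _ := by ring
  intro n
  have h1 : (ρ⁻¹) ^ n * u n ≤ u 0 * (1 + C) ^ n := by
    refine le_trans ?_ (hS n)
    exact Finset.single_le_sum (f := fun j => (ρ⁻¹) ^ j * u j)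
      (fun j _ => mul_nonneg (by positivity) (hu j)) (by simp)
  have h0 := hu 0
  calc u n = ρ ^ n * ((ρ⁻¹) ^ n * u n) := by
        rw [← mul_assoc, ← mul_pow, mul_inv_cancel₀ hρ.ne']; simp
    _ ≤ ρ ^ n * (u 0 * (1 + C) ^ n) := by gcongr
    _ = u 0 * 1 * (ρ * (1 + C)) ^ n := by rw [mul_pow]; ring
    _ ≤ _ := by gcongr; linarith

lemma aux_summable {c : ℕ → ℝ} {K R t : ℝ} (hR : 0 < R) (hc : ∀ n, |c n| ≤ K * R ^ n)
    (ht : |t| * R < 1) : Summable (fun n => ‖c n * t ^ n‖) := by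
  have hg := (summable_geometric_of_lt_one (by positivity) ht).mul_left K
  refine Summable.of_nonneg_of_le (fun _ => norm_nonneg _) (fun n => ?_) hg
  rw [Real.norm_eq_abs, abs_mul, abs_pow]
  calc _ ≤ K * R ^ n * |t| ^ n := by gcongr; exact hc n
    _ = _ := by rw [mul_pow]; ring

lemma aux_euler {c : ℕ → ℝ} {K R t : ℝ} (hR : 0 < R) (hc : ∀ n, |c n| ≤ K * R ^ n)
    (ht : |t| * R < 1) : ∃ w, HasDerivAt (fun x => ∑' n, c n * x ^ n) w t ∧
      HasSum (fun n : ℕ => (n:ℝ) * (c n * t ^ n)) (t * w) := by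
  obtain ⟨s, hs1, hs2⟩ := exists_between ((lt_div_iff₀ hR).2 ht)
  have hs0 : 0 < s := lt_of_le_of_lt (abs_nonneg t) hs1
  have hsR : ‖s * R‖ < 1 := by
    rw [Real.norm_eq_abs, abs_of_pos (by positivity)]; exact (lt_div_iff₀ hR).1 hs2
  have hu : Summable (fun n : ℕ => K * s⁻¹ * ((n:ℝ) ^ 1 * (s * R) ^ n)) :=
    (summable_pow_mul_geometric_of_norm_lt_one 1 hsR).mul_left _
  have hK : 0 ≤ K := by have := hc 0; simp at this; exact (abs_nonneg _).trans this
  have hb : ∀ n y, y ∈ Ioo (-s) s → ‖c n * ((n:ℝ) * y ^ (n-1))‖ ≤ K * s⁻¹ * ((n:ℝ) ^ 1 * (s * R) ^ n) := by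
    intro n y hy
    have hy' : |y| ≤ s := abs_le.2 ⟨hy.1.le, hy.2.le⟩
    rcases n with _ | n
    · simp
    · simp only [Real.norm_eq_abs, abs_mul, abs_pow, Nat.abs_cast, Nat.add_sub_cancel]
      calc _ ≤ (K * R ^ (n+1)) * (((n+1:ℕ):ℝ) * s ^ n) := by gcongr; exact hc _
        _ = _ := by rw [mul_pow, pow_succ s]; field_simp
  have hmem : t ∈ Ioo (-s) s := abs_lt.1 hs1
  refine ⟨∑' n : ℕ, c n * ((n:ℝ) * t ^ (n-1)), ?_, ?_⟩
  · exact hasDerivAt_tsum_of_isPreconnected (t := Ioo (-s) s) hu isOpen_Ioo isPreconnected_Ioo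
      (g := fun n x => c n * x ^ n) (g' := fun n x => c n * ((n:ℝ) * x ^ (n-1)))
      (fun n y _ => (hasDerivAt_pow n y).const_mul _) hb hmem
      (aux_summable hR hc ht).of_norm hmem
  · have : Summable (fun n : ℕ => c n * ((n:ℝ) * t ^ (n-1))) :=
      Summable.of_norm_bounded hu (fun n => hb n t hmem)
    convert! this.hasSum.mul_left t using 2 with n
    rcases n with _ | n
    · simp
    · simp [pow_succ]; ring

noncomputable def auxCoef (k : ℝ) (p q r : ℕ → ℝ) : ℕ → ℝ × ℝ
  | 0 => (0, 1)
  | (n+1) =>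
    ((∑ j : Fin (n+1), (p (n+1-j) * (auxCoef k p q r j).1 + q (n+1-j) * (auxCoef k p q r j).2)) / (2*k+(n+1)),
     (∑ j : Fin (n+1), (-q (n+1-j) * (auxCoef k p q r j).1 + r (n+1-j) * (auxCoef k p q r j).2)) / (n+1))
  termination_by n => n

lemma auxCoef_rec {k : ℝ} (hk : 0 < k) {p q r : ℕ → ℝ} (hp : p 0 = -k) (hq : q 0 = 0) (hr : r 0 = k) (n : ℕ) :
    (k + n) * (auxCoef k p q r n).1 = ∑ ij ∈ Finset.HasAntidiagonal.antidiagonal n,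
      ((auxCoef k p q r ij.1).1 * p ij.2 + (auxCoef k p q r ij.1).2 * q ij.2) ∧
    (k + n) * (auxCoef k p q r n).2 = ∑ ij ∈ Finset.HasAntidiagonal.antidiagonal n,
      (-((auxCoef k p q r ij.1).1 * q ij.2) + (auxCoef k p q r ij.1).2 * r ij.2) := by
  rcases n with _ | n
  · simp [auxCoef, hp, hq, hr]
  · rw [Finset.Nat.sum_antidiagonal_eq_sum_range_succ (fun i j => (auxCoef k p q r i).1 * p j + (auxCoef k p q r i).2 * q j),
      Finset.Nat.sum_antidiagonal_eq_sum_range_succ (fun i j => -((auxCoef k p q r i).1 * q j) + (auxCoef k p q r i).2 * r j),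
      Finset.sum_range_succ, Finset.sum_range_succ _ (n+1), Finset.sum_range, Finset.sum_range]
    simp only [Nat.sub_self, hp, hq, hr]
    have e1 : (2*k+(n+1)) * (auxCoef k p q r (n+1)).1 = ∑ j : Fin (n+1), (p (n+1-j) * (auxCoef k p q r j).1 + q (n+1-j) * (auxCoef k p q r j).2) := by
      rw [auxCoef]; simp only; rw [mul_div_cancel₀]; positivity
    have e2 : ((n:ℝ)+1) * (auxCoef k p q r (n+1)).2 = ∑ j : Fin (n+1), (-q (n+1-j) * (auxCoef k p q r j).1 + r (n+1-j) * (auxCoef k p q r j).2) := by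
      rw [auxCoef]; simp only; rw [mul_div_cancel₀]; positivity
    constructor
    · have : ∑ i : Fin (n+1), ((auxCoef k p q r i).1 * p (n+1-i) + (auxCoef k p q r i).2 * q (n+1-i)) = (2*k+(n+1)) * (auxCoef k p q r (n+1)).1 := by
        rw [e1]; exact Finset.sum_congr rfl fun j _ => by ring
      rw [this]; push_cast; ring
    · have : ∑ i : Fin (n+1), (-((auxCoef k p q r i).1 * q (n+1-i)) + (auxCoef k p q r i).2 * r (n+1-i)) = (n+1) * (auxCoef k p q r (n+1)).2 := by
        rw [e2]; exact Finset.sum_congr rfl fun j _ => by ring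
      rw [this]; push_cast; ring

lemma auxCoef_bound {k : ℝ} (hk : 0 < k) {p q r : ℕ → ℝ} {C ρ : ℝ} (hC : 0 ≤ C) (hρ : 0 < ρ)
    (hp : ∀ n, |p n| ≤ C * ρ ^ n) (hq : ∀ n, |q n| ≤ C * ρ ^ n) (hr : ∀ n, |r n| ≤ C * ρ ^ n) :
    ∃ K, ∀ n, |(auxCoef k p q r n).1| ≤ K * (ρ * (1 + 2 * C)) ^ n ∧
      |(auxCoef k p q r n).2| ≤ K * (ρ * (1 + 2 * C)) ^ n := by
  set a := fun n => (auxCoef k p q r n).1 with ha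
  set b := fun n => (auxCoef k p q r n).2 with hb
  have main : ∀ (x y : ℕ → ℝ), (∀ n, |x n| ≤ C * ρ ^ n) → (∀ n, |y n| ≤ C * ρ ^ n) → ∀ n : ℕ, ∀ d : ℝ, 1 ≤ d →
      |(∑ j : Fin n, (x (n-j) * a j + y (n-j) * b j)) / d| ≤ C * ∑ j ∈ Finset.range n, ρ ^ (n-j) * (|a j| + |b j|) := by
    intro x y hx hy n d hd
    rw [abs_div, abs_of_pos (by linarith : 0 < d)]
    refine (div_le_self (abs_nonneg _) hd).trans ?_
    refine (Finset.abs_sum_le_sum_abs _ _).trans ?_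
    rw [Finset.sum_range, Finset.mul_sum]
    refine Finset.sum_le_sum fun j _ => ?_
    refine (abs_add_le _ _).trans ?_
    rw [abs_mul, abs_mul]
    calc _ ≤ C * ρ ^ (n - (j:ℕ)) * |a j| + C * ρ ^ (n - (j:ℕ)) * |b j| := by
          gcongr
          · exact hx _
          · exact hy _
      _ = _ := by ring
  have hg := aux_growth (u := fun n => |a n| + |b n|) (C := 2 * C) (ρ := ρ) (by positivity) hρ ?_
    (fun n => by positivity)
  · refine ⟨_, fun n => ⟨le_trans ?_ (hg n), le_trans ?_ (hg n)⟩⟩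
    · exact le_add_of_nonneg_right (abs_nonneg _)
    · exact le_add_of_nonneg_left (abs_nonneg _)
  · intro n hn
    obtain ⟨m, rfl⟩ : ∃ m, n = m + 1 := ⟨n - 1, by omega⟩
    have hm : (0:ℝ) ≤ m := Nat.cast_nonneg m
    have A := main p q hp hq (m+1) (2*k+(m+1)) (by linarith)
    have B := main (fun n => -q n) r (by simpa using hq) hr (m+1) (m+1) (by linarith)
    have hA : a (m+1) = (∑ j : Fin (m+1), (p (m+1-j) * a j + q (m+1-j) * b j)) / (2*k+(m+1)) := by
      simp only [ha, hb]; rw [auxCoef]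
    have hB : b (m+1) = (∑ j : Fin (m+1), (-q (m+1-j) * a j + r (m+1-j) * b j)) / (m+1) := by
      simp only [ha, hb]; rw [auxCoef]
    rw [← hA] at A
    rw [← hB] at B
    linarith

lemma aux_hasSum_mul {f g : ℕ → ℝ} {t : ℝ} (hf : Summable fun n => ‖f n * t ^ n‖)
    (hg : Summable fun n => ‖g n * t ^ n‖) {s : ℝ} (hs : HasSum (fun n => g n * t ^ n) s) :
    HasSum (fun n => (∑ ij ∈ Finset.HasAntidiagonal.antidiagonal n, f ij.1 * g ij.2) * t ^ n)
      ((∑' n, f n * t ^ n) * s) := by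
  rw [← hs.tsum_eq, tsum_mul_tsum_eq_tsum_sum_antidiagonal_of_summable_norm hf hg]
  have := (summable_norm_sum_mul_antidiagonal_of_summable_norm hf hg).of_norm.hasSum
  convert! this using 2 with n
  · rw [Finset.sum_mul]
    refine Finset.sum_congr rfl fun ij hij => ?_
    rw [← Finset.HasAntidiagonal.mem_antidiagonal.1 hij, pow_add]; ring

lemma aux_frob {k : ℝ} (hk : 0 < k) {P Q R : ℝ → ℝ} (hP : AnalyticAt ℝ P 0)
    (hQ : AnalyticAt ℝ Q 0) (hR : AnalyticAt ℝ R 0) (hQ' : deriv Q 0 = 0) :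
    ∃ α β : ℕ → ℝ, α 0 = 0 ∧ β 0 = 1 ∧ α 1 = Q 0 / (2*k+1) ∧ β 1 = 0 ∧ α 2 = 0 ∧
      β 2 = (R 0 - Q 0 * (Q 0 / (2*k+1))) / 2 ∧ ∃ ε, 0 < ε ∧ ∀ t ∈ Ioo 0 ε,
      Summable (fun n => α n * t ^ n) ∧ Summable (fun n => β n * t ^ n) ∧
      HasDerivAt (fun x => x ^ k * ∑' n, α n * x ^ n)
        (t ^ k * ((-k / t + t * P t) * (∑' n, α n * t ^ n) + Q t * (∑' n, β n * t ^ n))) t ∧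
      HasDerivAt (fun x => x ^ k * ∑' n, β n * x ^ n)
        (t ^ k * (-Q t * (∑' n, α n * t ^ n) + (k / t + t * R t) * (∑' n, β n * t ^ n))) t := by
  obtain ⟨cP, P0, P1, hcP⟩ := aux_ser hP
  obtain ⟨cQ, Q0, Q1, hcQ⟩ := aux_ser hQ
  obtain ⟨cR, R0, R1, hcR⟩ := aux_ser hR
  set cons : ℝ → (ℕ → ℝ) → ℕ → ℝ := fun a c n => Nat.casesOn n a c with hcons
  set p := cons (-k) (cons 0 cP) with hp
  set q := cons 0 cQ with hq
  set r := cons k (cons 0 cR) with hr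
  have sp : ∀ᶠ t in 𝓝 (0:ℝ), HasSum (fun n => p n * t ^ n) (-k + t * (0 + t * P t)) := by
    filter_upwards [hcP] with t ht
    exact aux_cons (aux_cons ht)
  have sq : ∀ᶠ t in 𝓝 (0:ℝ), HasSum (fun n => q n * t ^ n) (0 + t * Q t) := by
    filter_upwards [hcQ] with t ht
    exact aux_cons ht
  have sr : ∀ᶠ t in 𝓝 (0:ℝ), HasSum (fun n => r n * t ^ n) (k + t * (0 + t * R t)) := by
    filter_upwards [hcR] with t ht
    exact aux_cons (aux_cons ht)
  obtain ⟨C1, hC1, ρ1, hρ1, b1⟩ := aux_bound sp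
  obtain ⟨C2, hC2, ρ2, hρ2, b2⟩ := aux_bound sq
  obtain ⟨C3, hC3, ρ3, hρ3, b3⟩ := aux_bound sr
  obtain ⟨ρ, hρ⟩ : ∃ ρ, ρ = ρ1 + ρ2 + ρ3 := ⟨_, rfl⟩
  obtain ⟨C, hC⟩ : ∃ C, C = C1 + C2 + C3 := ⟨_, rfl⟩
  have hρ0 : 0 < ρ := by linarith
  have hC0 : 0 ≤ C := by linarith
  have b1 : ∀ n, |p n| ≤ C * ρ ^ n := fun n => (b1 ρ (by linarith) n).trans (by gcongr; linarith)
  have b2 : ∀ n, |q n| ≤ C * ρ ^ n := fun n => (b2 ρ (by linarith) n).trans (by gcongr; linarith)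
  have b3 : ∀ n, |r n| ≤ C * ρ ^ n := fun n => (b3 ρ (by linarith) n).trans (by gcongr; linarith)
  obtain ⟨K, hK⟩ := auxCoef_bound hk hC0 hρ0 b1 b2 b3
  have hrec := auxCoef_rec (p := p) (q := q) (r := r) hk rfl rfl rfl
  obtain ⟨S, hS⟩ : ∃ S, S = ρ * (1 + 2 * C) := ⟨_, rfl⟩
  rw [← hS] at hK
  have hS0 : 0 < S := by rw [hS]; positivity
  have hSρ : ρ ≤ S := by rw [hS]; nlinarith [mul_nonneg hρ0.le hC0]
  have c1 : (auxCoef k p q r 1).1 = Q 0 / (2*k+1) := by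
    rw [auxCoef]; simp [auxCoef, hq, hcons, Q0]
  have c2 : (auxCoef k p q r 1).2 = 0 := by
    rw [auxCoef]; simp [auxCoef, hr, hcons]
  obtain ⟨ε, hε, hev⟩ := Metric.eventually_nhds_iff.1 (sp.and (sq.and sr))
  refine ⟨fun n => (auxCoef k p q r n).1, fun n => (auxCoef k p q r n).2, by simp [auxCoef],
    by simp [auxCoef], c1, c2, ?_, ?_, min ε S⁻¹, lt_min hε (inv_pos.2 hS0), ?_⟩
  · simp only
    rw [auxCoef]
    simp [Fin.sum_univ_two, c1, c2]
    left
    rw [show p 1 = 0 from rfl, show q 2 = 0 from Q1.trans hQ']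
    simp [auxCoef]
  · simp only
    rw [auxCoef]
    simp [Fin.sum_univ_two, c1, c2]
    rw [show r 2 = R 0 from R0, show q 1 = Q 0 from Q0]
    simp [auxCoef]
    ring
  · intro t ht
    have ht0 : 0 < t := ht.1
    have htS : |t| * S < 1 := by
      rw [abs_of_pos ht0]
      have := ht.2.trans_le (min_le_right _ _)
      rw [lt_inv_comm₀ ht0 hS0] at this
      calc t * S < t * t⁻¹ := by gcongr
        _ = 1 := mul_inv_cancel₀ ht0.ne'
    have htρ : |t| * ρ < 1 := lt_of_le_of_lt (by gcongr) htS
    obtain ⟨tp, tq, tr⟩ := hev (y := t) (by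
      simp [abs_of_pos ht0]; exact ht.2.trans_le (min_le_left _ _))
    have na := aux_summable (t := t) hS0 (fun n => (hK n).1) htS
    have nb := aux_summable (t := t) hS0 (fun n => (hK n).2) htS
    have np := aux_summable (t := t) hρ0 b1 htρ
    have nq := aux_summable (t := t) hρ0 b2 htρ
    have nr := aux_summable (t := t) hρ0 b3 htρ
    obtain ⟨w1, d1, e1⟩ := aux_euler (t := t) hS0 (fun n => (hK n).1) htS
    obtain ⟨w2, d2, e2⟩ := aux_euler (t := t) hS0 (fun n => (hK n).2) htS
    have hpow := Real.hasDerivAt_rpow_const (x := t) (p := k) (Or.inl ht0.ne')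
    have hpk : t ^ (k - 1) = t ^ k / t := by rw [Real.rpow_sub_one ht0.ne']
    refine ⟨na.of_norm, nb.of_norm, ?_, ?_⟩
    · have h1 := (aux_hasSum_mul na np tp).add (aux_hasSum_mul nb nq tq)
      have h2 := (na.of_norm.hasSum.mul_left k).add e1
      have h3 := HasSum.unique h2 (by
        convert! h1 using 2 with n
        have h4 := (hrec n).1
        rw [Finset.sum_add_distrib] at h4
        linear_combination t ^ n * h4)
      convert! hpow.mul d1 using 1
      rw [hpk]
      field_simp
      linear_combination -h3
    · have h1 := (aux_hasSum_mul na nq tq).neg.add (aux_hasSum_mul nb nr tr)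
      have h2 := (nb.of_norm.hasSum.mul_left k).add e2
      have h3 := HasSum.unique h2 (by
        convert! h1 using 2 with n
        have h4 := (hrec n).2
        rw [Finset.sum_add_distrib, Finset.sum_neg_distrib] at h4
        linear_combination t ^ n * h4)
      convert! hpow.mul d2 using 1
      rw [hpk]
      field_simp
      linear_combination -h3



theorem stmt19 (k ζ ξ μ : ℝ) (hk : ∃ n : ℕ, k = 1 / 2 + n) (hζ : ζ ∈ Ico (0 : ℝ) 1) :
    ∃ ε : ℝ, 0 < ε ∧ ε < Real.pi ∧
      ∃ v : ℕ → Fin 2 → ℂ,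
        v 0 = ![0, 1] ∧
        v 1 = ![Complex.I * (μ : ℂ) / (((2 * k + 1) * Real.sqrt (1 + ζ) : ℝ) : ℂ), 0] ∧
        v 2 = ![0, ((k / 12 + ζ / (4 * (1 + ζ)) + (ζ * k - ξ) / (2 * (1 + ζ)) -
          μ ^ 2 / (2 * (2 * k + 1) * (1 + ζ)) : ℝ) : ℂ)] ∧
        (∀ θ ∈ Ioo (0 : ℝ) ε, Summable fun n : ℕ => (θ ^ (k + (n : ℝ))) • v n) ∧
        ∀ θ ∈ Ioo (0 : ℝ) ε,
          HasDerivAt (fun t : ℝ => ∑' n : ℕ, (t ^ (k + (n : ℝ))) • v n)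
            ((Amat k ζ ξ μ θ).mulVec (∑' n : ℕ, (θ ^ (k + (n : ℝ))) • v n)) θ := by
  obtain ⟨N, hN⟩ := hk
  have hk : 0 < k := by rw [hN]; positivity
  have hζ0 : 0 ≤ ζ := hζ.1
  have hΔ : ∀ t : ℝ, 0 < 1 + ζ * Real.cos t ^ 2 := fun t => by positivity
  obtain ⟨D, hD, hD0, hDs⟩ := aux_sinc
  have hsinc : AnalyticAt ℝ Real.sinc 0 := by
    rw [Real.sinc_eq_dslope]; exact aux_dslope Real.analyticAt_sin
  have hcos : AnalyticAt ℝ Real.cos 0 := Real.analyticAt_cos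
  have hΔa : AnalyticAt ℝ (fun t : ℝ => 1 + ζ * Real.cos t ^ 2) 0 :=
    analyticAt_const.add (analyticAt_const.mul (hcos.pow 2))
  have hsq : AnalyticAt ℝ (fun t : ℝ => Real.sqrt (1 + ζ * Real.cos t ^ 2)) 0 :=
    (hΔa.contDiffAt.sqrt (hΔ 0).ne').analyticAt
  have hQ : AnalyticAt ℝ (fun t : ℝ => μ / Real.sqrt (1 + ζ * Real.cos t ^ 2)) 0 :=
    analyticAt_const.div hsq (Real.sqrt_pos.2 (hΔ 0)).ne'
  have hX : AnalyticAt ℝ (fun t : ℝ => k * (D t / Real.sinc t)) 0 :=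
    analyticAt_const.mul (hD.div hsinc (by simp))
  have hY : AnalyticAt ℝ (fun t : ℝ => ζ * Real.sinc t * Real.cos t / (2 * (1 + ζ * Real.cos t ^ 2))) 0 :=
    ((analyticAt_const.mul hsinc).mul hcos).div (analyticAt_const.mul hΔa)
      (mul_pos two_pos (hΔ 0)).ne'
  have hZ : AnalyticAt ℝ (fun t : ℝ => (ζ * k - ξ) * Real.sinc t / (1 + ζ * Real.cos t ^ 2)) 0 :=
    (analyticAt_const.mul hsinc).div hΔa (hΔ 0).ne'
  obtain ⟨α, β, a0, b0, a1, b1, a2, b2, ε, hε, H⟩ := aux_frob hk ((hX.add hY).sub hZ) hQ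
    ((hY.sub hX).add hZ) (aux_even (fun x => by simp))
  have hsum : ∀ t ∈ Ioo (0:ℝ) ε, HasSum (fun n : ℕ => (t ^ (k + (n : ℝ))) • (![Complex.I * (α n : ℂ), (β n : ℂ)] : Fin 2 → ℂ))
      ![Complex.I * ((t ^ k * ∑' n, α n * t ^ n : ℝ) : ℂ), ((t ^ k * ∑' n, β n * t ^ n : ℝ) : ℂ)] := by
    intro t ht
    obtain ⟨s1, s2, -, -⟩ := H t ht
    have e : ∀ n : ℕ, t ^ (k + (n:ℝ)) = t ^ k * t ^ n := fun n => by
      rw [Real.rpow_add ht.1, Real.rpow_natCast]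
    rw [Pi.hasSum]
    intro i
    fin_cases i
    · have := (Complex.hasSum_ofReal.2 (s1.hasSum.mul_left (t ^ k))).mul_left Complex.I
      convert! this using 2 with n
      simp [e]; ring
    · have := (Complex.hasSum_ofReal.2 (s2.hasSum.mul_left (t ^ k)))
      convert! this using 2 with n
      simp [e]; ring
  have hpi := Real.pi_gt_three
  refine ⟨min ε 3, lt_min hε (by norm_num), (min_le_right _ _).trans_lt hpi,
    fun n => ![Complex.I * (α n : ℂ), (β n : ℂ)], ?_, ?_, ?_, ?_, ?_⟩
  · simp [a0, b0]
  · simp only [a1, b1, Real.cos_zero]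
    congr 1
    · push_cast
      simp
      field_simp
  · simp only [a2, b2]
    congr 1
    · simp
    · congr 2
      simp [hD0]
      have h1 : 0 < 1 + ζ := by linarith
      have h2 : 0 < 2 * k + 1 := by linarith
      have h3 : μ / √(1 + ζ) * (μ / √(1 + ζ) / (2 * k + 1)) = μ ^ 2 / ((1 + ζ) * (2 * k + 1)) := by
        rw [div_div, div_mul_div_comm, ← mul_assoc, Real.mul_self_sqrt h1.le]; ring
      rw [h3]
      field_simp
      ring
  · intro θ hθ
    exact (hsum θ ⟨hθ.1, hθ.2.trans_le (min_le_left _ _)⟩).summable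
  · intro θ hθ
    have hθ' : θ ∈ Ioo (0:ℝ) ε := ⟨hθ.1, hθ.2.trans_le (min_le_left _ _)⟩
    have h0 : 0 < θ := hθ.1
    have hsin : 0 < Real.sin θ := Real.sin_pos_of_pos_of_lt_pi h0
      ((hθ.2.trans_le (min_le_right _ _)).trans hpi)
    obtain ⟨-, -, d1, d2⟩ := H θ hθ'
    have hscn : Real.sinc θ = Real.sin θ / θ := Real.sinc_of_ne_zero h0.ne'
    have hDθ : D θ = (Real.sin θ / θ - 1) / θ ^ 2 := by
      have := hDs θ
      rw [hscn] at this
      rw [this]; field_simp; ring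
    have hev : (fun t : ℝ => ∑' n : ℕ, (t ^ (k + (n : ℝ))) • (![Complex.I * (α n : ℂ), (β n : ℂ)] : Fin 2 → ℂ)) =ᶠ[𝓝 θ]
        fun t => ![Complex.I * ((t ^ k * ∑' n, α n * t ^ n : ℝ) : ℂ), ((t ^ k * ∑' n, β n * t ^ n : ℝ) : ℂ)] := by
      filter_upwards [isOpen_Ioo.mem_nhds hθ'] with t ht
      exact (hsum t ht).tsum_eq
    refine HasDerivAt.congr_of_eventuallyEq ?_ hev
    rw [(hsum θ hθ').tsum_eq]
    rw [hasDerivAt_pi]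
    generalize hA : (∑' n, α n * θ ^ n) = A at *
    generalize hB : (∑' n, β n * θ ^ n) = B at *
    have hΔθ := hΔ θ
    have hcd : (2 * (1 + ζ * Real.cos θ ^ 2)) ≠ 0 := by positivity
    have E1 : -k / θ + θ * (k * (D θ / Real.sinc θ) + ζ * Real.sinc θ * Real.cos θ / (2 * (1 + ζ * Real.cos θ ^ 2)) - (ζ * k - ξ) * Real.sinc θ / (1 + ζ * Real.cos θ ^ 2))
      = - (k / Real.sin θ) + ζ * Real.sin (2 * θ) / (4 * (1 + ζ * Real.cos θ ^ 2)) - (ζ * k - ξ) * Real.sin θ / (1 + ζ * Real.cos θ ^ 2) := by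
      rw [hDθ, hscn, Real.sin_two_mul]
      field_simp
      ring
    have E2 : k / θ + θ * (ζ * Real.sinc θ * Real.cos θ / (2 * (1 + ζ * Real.cos θ ^ 2)) - k * (D θ / Real.sinc θ) + (ζ * k - ξ) * Real.sinc θ / (1 + ζ * Real.cos θ ^ 2))
      = k / Real.sin θ + ζ * Real.sin (2 * θ) / (4 * (1 + ζ * Real.cos θ ^ 2)) + (ζ * k - ξ) * Real.sin θ / (1 + ζ * Real.cos θ ^ 2) := by
      rw [hDθ, hscn, Real.sin_two_mul]
      field_simp
      ring
    simp only [Pi.add_apply, Pi.sub_apply] at d1 d2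
    rw [E1] at d1
    rw [E2] at d2
    intro i
    fin_cases i
    · convert! d1.ofReal_comp.const_mul Complex.I using 1
      simp [Amat, Matrix.mulVec, dotProduct, Fin.sum_univ_two]
      ring
    · convert! d2.ofReal_comp using 1
      simp [Amat, Matrix.mulVec, dotProduct, Fin.sum_univ_two]
      linear_combination ((μ:ℂ) * ((√(1 + ζ * Real.cos θ ^ 2) : ℝ) : ℂ)⁻¹ * ((θ ^ k : ℝ) : ℂ) * (A:ℂ)) * Complex.I_sq
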